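/- Let R be a ring, C = C_R and 'C = 'C_R. The following statements are equivalent: (1) C is a left Ore set of R and Q_{l,cl}(R) := C⁻¹R is a semisimple Artinian ring; (2) R is a semiprime ring, udim(_R R) < ∞, R satisfies the ascending chain condition on right annihilators, and 'C_U ≠ ∅ for all uniform left ideals U of R; (3) R is a semiprime ring, udim(_R R) < ∞, the set {ker(c·_R) | c ∈ 'C} of left annihilators of elements of 'C satisfies the ascending chain condition, and 'C_U ≠ ∅ for all uniform left ideals U of R; (4) R is a semiprime ring, udim(_R R) < ∞, the set {ker(r·_R) | r ∈ R} of left annihilators of single elements satisfies the ascending chain condition, and 'C_U ≠ ∅ for all uniform left ideals U of R. -/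

import Mathlib

universe u

namespace Bavula

/-- The set of left regular elements of `R`. -/
def lReg (R : Type u) [Ring R] : Set R := {c : R | ∀ x : R, x * c = 0 → x = 0}

/-- The set of right regular elements of `R`. -/
def rReg (R : Type u) [Ring R] : Set R := {c : R | ∀ x : R, c * x = 0 → x = 0}

/-- The set of regular elements of `R`. -/
def reg (R : Type u) [Ring R] : Set R := lReg R ∩ rReg R

/-- `S` is a multiplicative set of `R`. -/
def IsMulSet {R : Type u} [Ring R] (S : Set R) : Prop :=
  (1 : R) ∈ S ∧ (∀ a ∈ S, ∀ b ∈ S, a * b ∈ S) ∧ (0 : R) ∉ S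

/-- `S` is a left Ore set of `R`. -/
def IsLeftOre {R : Type u} [Ring R] (S : Set R) : Prop :=
  IsMulSet S ∧ ∀ s ∈ S, ∀ r : R, ∃ s' ∈ S, ∃ r' : R, s' * r = r' * s

/-- `S` is a left denominator set of `R`. -/
def IsLeftDenom {R : Type u} [Ring R] (S : Set R) : Prop :=
  IsLeftOre S ∧ ∀ r : R, ∀ s ∈ S, r * s = 0 → ∃ t ∈ S, t * r = 0

/-- `S` is a right Ore set of `R`. -/
def IsRightOre {R : Type u} [Ring R] (S : Set R) : Prop :=
  IsMulSet S ∧ ∀ s ∈ S, ∀ r : R, ∃ s' ∈ S, ∃ r' : R, r * s' = s * r'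

/-- `S` is a right denominator set of `R`. -/
def IsRightDenom {R : Type u} [Ring R] (S : Set R) : Prop :=
  IsRightOre S ∧ ∀ r : R, ∀ s ∈ S, s * r = 0 → ∃ t ∈ S, r * t = 0

/-- `ass_R(S) = {r ∈ R | s r = 0 for some s ∈ S}`. -/
def ass {R : Type u} [Ring R] (S : Set R) : Set R := {r : R | ∃ s ∈ S, s * r = 0}

/-- `{r ∈ R | r s = 0 for some s ∈ S}` (the right-sided analogue of `ass`). -/
def rass {R : Type u} [Ring R] (S : Set R) : Set R := {r : R | ∃ s ∈ S, r * s = 0}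

/-- `S` is a (left) dense subset of `T`. -/
def DenseIn {R : Type u} [Ring R] (S T : Set R) : Prop := ∀ t ∈ T, ∃ r : R, r * t ∈ S

/-- `f : R →+* Q` realizes `Q` as the left localization `S⁻¹R` of `R` at `S`:
elements of `S` become units, every element of `Q` is a left fraction `(f s)⁻¹ * (f r)`,
and the kernel of `f` is `ass S`. -/
def IsLeftLoc {R : Type u} [Ring R] (S : Set R) {Q : Type u} [Ring Q] (f : R →+* Q) : Prop :=
  (∀ s ∈ S, IsUnit (f s)) ∧
  (∀ q : Q, ∃ s ∈ S, ∃ r : R, f s * q = f r) ∧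
  (∀ r : R, f r = 0 ↔ r ∈ ass S)

/-- `π : R →+* Q` realizes `Q` as the quotient of `R` by the set `a`
(in particular, `a` is then a two-sided ideal of `R`). -/
def IsQuotBy {R : Type u} [Ring R] (a : Set R) {Q : Type u} [Ring Q] (π : R →+* Q) : Prop :=
  Function.Surjective π ∧ ∀ r : R, π r = 0 ↔ r ∈ a

/-- A semiprime ring (no nonzero nilpotent ideals), elementwise: `x R x = 0 → x = 0`. -/
def SemiprimeRing (A : Type u) [Ring A] : Prop := ∀ x : A, (∀ r : A, x * r * x = 0) → x = 0

/-- `a` is a two-sided ideal of `R`, given as a set. -/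
def IsIdealSet {R : Type u} [Ring R] (a : Set R) : Prop :=
  (0 : R) ∈ a ∧ (∀ x ∈ a, ∀ y ∈ a, x + y ∈ a) ∧ ∀ r : R, ∀ x ∈ a, r * x ∈ a ∧ x * r ∈ a

/-- `a` is a semiprime (two-sided) ideal of `R`, i.e. `R/a` is a semiprime ring. -/
def IsSemiprimeIdealSet {R : Type u} [Ring R] (a : Set R) : Prop :=
  IsIdealSet a ∧ ∀ x : R, (∀ r : R, x * r * x ∈ a) → x ∈ a

/-- `a` is a prime (two-sided) ideal of `R`, i.e. `R/a` is a prime ring. -/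
def IsPrimeIdealSet {R : Type u} [Ring R] (a : Set R) : Prop :=
  IsIdealSet a ∧ a ≠ Set.univ ∧ ∀ x y : R, (∀ r : R, x * r * y ∈ a) → x ∈ a ∨ y ∈ a

/-- The prime radical of `A`: the intersection of all prime ideals of `A`. -/
def primeRadical (A : Type u) [Ring A] : Set A :=
  {x : A | ∀ p : Set A, IsPrimeIdealSet p → x ∈ p}

/-- The set of prime ideals of `R` minimal over `a`. -/
def minPrimesOver {R : Type u} [Ring R] (a : Set R) : Set (Set R) :=
  {p : Set R | IsPrimeIdealSet p ∧ a ⊆ p ∧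
    ∀ q : Set R, IsPrimeIdealSet q → a ⊆ q → q ⊆ p → q = p}

/-- A simple ring: nontrivial, with no two-sided ideals other than `0` and `A`. -/
def SimpleRing (A : Type u) [Ring A] : Prop :=
  (0 : A) ≠ 1 ∧ ∀ a : Set A, IsIdealSet a → a = {0} ∨ a = Set.univ

/-- A simple (left) Artinian ring. -/
def SimpleArtinianRing (A : Type u) [Ring A] : Prop := SimpleRing A ∧ IsArtinianRing A

/-- `I` is an essential left ideal of `R`. -/
def EssIdeal {R : Type u} [Ring R] (I : Submodule R R) : Prop :=
  ∀ J : Submodule R R, J ≠ ⊥ → I ⊓ J ≠ ⊥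

/-- `N` is an essential submodule of the left ideal `M`. -/
def EssIn {R : Type u} [Ring R] (N M : Submodule R R) : Prop :=
  N ≤ M ∧ ∀ W : Submodule R R, W ≤ M → W ≠ ⊥ → N ⊓ W ≠ ⊥

/-- `U` is a uniform left ideal of `R`. -/
def UniformIdeal {R : Type u} [Ring R] (U : Submodule R R) : Prop :=
  U ≠ ⊥ ∧ ∀ V W : Submodule R R, V ≤ U → W ≤ U → V ≠ ⊥ → W ≠ ⊥ → V ⊓ W ≠ ⊥

/-- `udim(_A A) < ∞`: there is a finite direct sum of uniform left ideals of `A`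
which is an essential left ideal of `A`. -/
def FinUdim (A : Type u) [Ring A] : Prop :=
  ∃ (n : ℕ) (U : Fin (n + 1) → Submodule A A),
    (∀ i, UniformIdeal (U i)) ∧
    (∀ i, U i ⊓ (⨆ j, ⨆ (_ : j ≠ i), U j) = ⊥) ∧
    EssIdeal (⨆ i, U i)

/-- `'C_V = {v ∈ V | right multiplication by v is injective on V}` for a left ideal `V`. -/
def lRegIn {R : Type u} [Ring R] (V : Submodule R R) : Set R :=
  {v : R | v ∈ V ∧ ∀ x ∈ V, x * v = 0 → x = 0}

/-- The family `P` of subsets of `R` satisfies the ascending chain condition. -/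
def AccOnSets {R : Type u} [Ring R] (P : Set (Set R)) : Prop :=
  ∀ f : ℕ → Set R, (∀ n, f n ∈ P) → (∀ n, f n ⊆ f (n + 1)) →
    ∃ N : ℕ, ∀ n : ℕ, N ≤ n → f n = f N

/-- The left annihilator of `X` in `R`. -/
def lAnn {R : Type u} [Ring R] (X : Set R) : Set R := {r : R | ∀ x ∈ X, r * x = 0}

/-- The right annihilator of `X` in `R`. -/
def rAnn {R : Type u} [Ring R] (X : Set R) : Set R := {r : R | ∀ x ∈ X, x * r = 0}

/-- A left Goldie ring: a.c.c. on left annihilators and finite left uniform dimension. -/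
def LeftGoldie (A : Type u) [Ring A] : Prop :=
  AccOnSets {B : Set A | ∃ X : Set A, B = lAnn X} ∧ FinUdim A

/-- The set of maximal left denominator sets of `A`. -/
def maxLeftDenom (A : Type u) [Ring A] : Set (Set A) :=
  {S : Set A | IsLeftDenom S ∧ ∀ T : Set A, IsLeftDenom T → S ⊆ T → S = T}

/-- `S_p = {c ∈ R | c + p ∈ C_{R/p}}`: the elements regular modulo `p`. -/
def regMod {R : Type u} [Ring R] (p : Set R) : Set R :=
  {c : R | (∀ x : R, x * c ∈ p → x ∈ p) ∧ ∀ x : R, c * x ∈ p → x ∈ p}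

/-- `I` is a right ideal of `R`, given as a set. -/
def IsRightIdealSet {R : Type u} [Ring R] (I : Set R) : Prop :=
  (0 : R) ∈ I ∧ (∀ x ∈ I, ∀ y ∈ I, x + y ∈ I) ∧ ∀ x ∈ I, ∀ r : R, x * r ∈ I

/-- The left singular ideal `ζ_l(R, a)` of `R` over `a`. -/
def leftSingularOver {R : Type u} [Ring R] (a : Set R) : Set R :=
  {r : R | ∃ I : Submodule R R, EssIdeal I ∧ a ⊆ I ∧ ∀ x ∈ I, x * r = 0}

section Helpers

variable {R : Type u} [Ring R]

/-- If `V` is nonzero it contains a nonzero element. -/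
lemma exists_ne_of_ne_bot {V : Submodule R R} (h : V ≠ ⊥) : ∃ x ∈ V, x ≠ 0 :=
  (Submodule.ne_bot_iff V).1 h

lemma ne_bot_of_mem {V : Submodule R R} {x : R} (hx : x ∈ V) (h0 : x ≠ 0) : V ≠ ⊥ :=
  (Submodule.ne_bot_iff V).2 ⟨x, hx, h0⟩

/-- The left ideal `{r | r x ∈ E}`. -/
def colon (E : Submodule R R) (x : R) : Submodule R R :=
  E.comap (LinearMap.toSpanSingleton R R x)

lemma mem_colon {E : Submodule R R} {x r : R} : r ∈ colon E x ↔ r * x ∈ E := by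
  simp [colon]

/-- The left ideal `J x`. -/
def mulR (J : Submodule R R) (x : R) : Submodule R R :=
  J.map (LinearMap.toSpanSingleton R R x)

lemma mem_mulR {J : Submodule R R} {x y : R} : y ∈ mulR J x ↔ ∃ j ∈ J, j * x = y := by
  simp [mulR]

/-- Relative version of essentiality of the colon ideal. -/
lemma ess_colon_rel {K M : Submodule R R}
    (hK : ∀ W : Submodule R R, W ≤ M → W ≠ ⊥ → K ⊓ W ≠ ⊥) {x : R} (hx : x ∈ M) :
    EssIdeal (colon K x) := by
  intro J hJ
  by_cases h : mulR J x = ⊥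
  · obtain ⟨j, hj, hj0⟩ := exists_ne_of_ne_bot hJ
    refine ne_bot_of_mem (x := j) ⟨?_, hj⟩ hj0
    have : j * x ∈ mulR J x := mem_mulR.2 ⟨j, hj, rfl⟩
    rw [h, Submodule.mem_bot] at this
    change j ∈ colon K x
    rw [mem_colon, this]
    exact K.zero_mem
  · have h2 := hK (mulR J x) (by
      intro y hy
      obtain ⟨j, _, rfl⟩ := mem_mulR.1 hy
      exact M.smul_mem j hx) h
    obtain ⟨y, ⟨hyK, hyJ⟩, hy0⟩ := exists_ne_of_ne_bot h2
    obtain ⟨j, hj, rfl⟩ := mem_mulR.1 hyJ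
    refine ne_bot_of_mem (x := j) ⟨mem_colon.2 hyK, hj⟩ ?_
    rintro rfl
    exact hy0 (zero_mul x)

lemma ess_colon {E : Submodule R R} (hE : EssIdeal E) (x : R) : EssIdeal (colon E x) :=
  ess_colon_rel (M := ⊤) (fun W _ h => hE W h) trivial

/-- If `N` meets every member of an independent family of uniform left ideals with essential sum,
then `N` is essential. -/
lemma ess_of_meets {n : ℕ} {U : Fin (n + 1) → Submodule R R}
    (hU : ∀ i, UniformIdeal (U i))
    (hind : ∀ i, U i ⊓ (⨆ j, ⨆ (_ : j ≠ i), U j) = ⊥)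
    (hess : EssIdeal (⨆ i, U i)) {N : Submodule R R} (hN : ∀ i, N ⊓ U i ≠ ⊥) :
    EssIdeal N := by
  classical
  have single : ∀ i, ∀ u ∈ U i, u ≠ 0 → ∃ r : R, r * u ≠ 0 ∧ r * u ∈ N := by
    intro i u hu hu0
    have h := (hU i).2 (Submodule.span R {u}) (N ⊓ U i)
      (by rw [Submodule.span_singleton_le_iff_mem]; exact hu) inf_le_right
      (ne_bot_of_mem (Submodule.mem_span_singleton_self u) hu0) (hN i)
    obtain ⟨y, ⟨hy1, hy2⟩, hy0⟩ := exists_ne_of_ne_bot h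
    obtain ⟨r, rfl⟩ := Submodule.mem_span_singleton.1 hy1
    exact ⟨r, hy0, hy2.1⟩
  have key : ∀ T : Finset (Fin (n + 1)), ∀ x ∈ ⨆ i ∈ T, U i, x ≠ 0 →
      ∃ r : R, r * x ≠ 0 ∧ r * x ∈ N := by
    intro T
    induction T using Finset.induction_on with
    | empty => intro x hx h0; simp at hx; exact absurd hx h0
    | insert t T ht ih =>
      intro x hx h0
      rw [Finset.iSup_insert] at hx
      obtain ⟨u, hu, y, hy, rfl⟩ := Submodule.mem_sup.1 hx
      have hy' : y ∈ ⨆ j, ⨆ (_ : j ≠ t), U j := by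
        have : (⨆ i ∈ T, U i) ≤ ⨆ j, ⨆ (_ : j ≠ t), U j := by
          refine iSup₂_le fun i hi => ?_
          exact le_iSup₂_of_le i (by rintro rfl; exact ht hi) le_rfl
        exact this hy
      have disj : ∀ r : R, r * (u + y) = 0 → r * u = 0 := by
        intro r hr
        have h1 : r * u ∈ U t := (U t).smul_mem r hu
        have h2 : r * u ∈ ⨆ j, ⨆ (_ : j ≠ t), U j := by
          have : r * u = (-r) * y := by
            rw [mul_add] at hr; rw [neg_mul]; exact eq_neg_of_add_eq_zero_left hr
          rw [this]
          exact Submodule.smul_mem _ (-r) hy'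
        have : r * u ∈ U t ⊓ (⨆ j, ⨆ (_ : j ≠ t), U j) := ⟨h1, h2⟩
        rw [hind t] at this
        simpa using this
      by_cases hy0 : y = 0
      · subst hy0
        rw [add_zero] at h0 ⊢
        exact single t u hu h0
      · obtain ⟨r, hr0, hrN⟩ := ih y hy hy0
        by_cases hru : r * u = 0
        · refine ⟨r, ?_, ?_⟩ <;> rw [mul_add, hru, zero_add] <;> assumption
        · obtain ⟨r', hr0', hrN'⟩ := single t (r * u) ((U t).smul_mem r hu) hru
          refine ⟨r' * r, ?_, ?_⟩
          · intro h
            have := disj _ h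
            rw [mul_assoc] at this
            exact hr0' this
          · rw [mul_add, mul_assoc, mul_assoc]
            exact N.add_mem hrN' (N.smul_mem r' hrN)
  intro J hJ
  obtain ⟨x, ⟨hx1, hx2⟩, hx0⟩ := exists_ne_of_ne_bot (hess J hJ)
  obtain ⟨r, hr0, hrN⟩ := key Finset.univ x (by simpa using hx1) hx0
  exact ne_bot_of_mem (x := r * x) ⟨hrN, J.smul_mem r hx2⟩ hr0

/-- A rank-like function: disjoint nonzero enlargement strictly decreases it. -/
lemma exists_codim (h : FinUdim R) : ∃ e : Submodule R R → ℕ,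
    ∀ V W : Submodule R R, V ≠ ⊥ → Disjoint W V → e (W ⊔ V) < e W := by
  classical
  obtain ⟨n, U, hU, hind, hess⟩ := h
  let F : Submodule R R → Finset (Finset (Fin (n + 1))) := fun W =>
    Finset.univ.filter fun T => Disjoint W (⨆ i ∈ T, U i)
  refine ⟨fun W => (F W).sup Finset.card, ?_⟩
  intro V W hV hWV
  have hne : (F (W ⊔ V)).Nonempty := ⟨∅, by simp [F]⟩
  obtain ⟨T, hT, hTe⟩ := Finset.exists_mem_eq_sup _ hne Finset.card
  change (F (W ⊔ V)).sup Finset.card < _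
  rw [hTe]
  have hT' : Disjoint (W ⊔ V) (⨆ i ∈ T, U i) := by simpa [F] using hT
  have hVd : Disjoint V (W ⊔ ⨆ i ∈ T, U i) := by
    rw [sup_comm] at hT'
    exact hWV.symm.disjoint_sup_right_of_disjoint_sup_left hT'
  have : ∃ i, Disjoint (W ⊔ ⨆ i ∈ T, U i) (U i) := by
    by_contra hcon
    push Not at hcon
    have := ess_of_meets hU hind hess (N := W ⊔ ⨆ i ∈ T, U i)
      (fun i h => hcon i (disjoint_iff.2 h)) V hV
    exact this (disjoint_iff.1 hVd.symm)
  obtain ⟨i, hi⟩ := this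
  have hiT : i ∉ T := by
    intro hiT
    have : U i ≤ W ⊔ ⨆ i ∈ T, U i := le_sup_of_le_right (le_iSup₂_of_le i hiT le_rfl)
    exact (hU i).1 (disjoint_self.1 (hi.mono_left this))
  have hWT : Disjoint W (⨆ i ∈ T, U i) := hT'.mono_left le_sup_left
  have hmem : insert i T ∈ F W := by
    simp only [F, Finset.mem_filter, Finset.mem_univ, true_and]
    rw [Finset.iSup_insert, sup_comm]
    exact hWT.disjoint_sup_right_of_disjoint_sup_left hi
  calc T.card < (insert i T).card := by rw [Finset.card_insert_of_notMem hiT]; omega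
    _ ≤ _ := Finset.le_sup (f := Finset.card) hmem

/-- Nonzero left ideals contain uniform left ideals. -/
lemma exists_uniform (h : FinUdim R) {L : Submodule R R} (hL : L ≠ ⊥) :
    ∃ U ≤ L, UniformIdeal U := by
  obtain ⟨e, he⟩ := exists_codim h
  have key : ∀ k : ℕ, ∀ W L : Submodule R R, e W = k → L ≠ ⊥ → Disjoint W L →
      ∃ U ≤ L, UniformIdeal U := by
    intro k
    induction k using Nat.strong_induction_on with
    | _ k ih =>
      intro W L hk hL hd
      by_cases hu : UniformIdeal L
      · exact ⟨L, le_rfl, hu⟩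
      · have : ∃ V L' : Submodule R R, V ≤ L ∧ L' ≤ L ∧ V ≠ ⊥ ∧ L' ≠ ⊥ ∧ V ⊓ L' = ⊥ := by
          by_contra hcon
          push Not at hcon
          exact hu ⟨hL, hcon⟩
        obtain ⟨V, L', hV, hL', hV0, hL0, hVL⟩ := this
        obtain ⟨U, hU1, hU2⟩ := ih _ (hk ▸ he V W hV0 (hd.mono_right hV)) (W ⊔ V) L' rfl hL0
          (by
            refine Disjoint.disjoint_sup_left_of_disjoint_sup_right (disjoint_iff.2 hVL) ?_
            exact hd.mono_right (sup_le hV hL'))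
        exact ⟨U, hU1.trans hL', hU2⟩
  exact key _ ⊥ L rfl hL disjoint_bot_left

/-- Essential left ideals contain left regular elements. -/
lemma exists_lReg_of_ess (h : FinUdim R)
    (hC : ∀ U : Submodule R R, UniformIdeal U → (lRegIn U).Nonempty)
    {I : Submodule R R} (hI : EssIdeal I) : ∃ c ∈ I, c ∈ lReg R := by
  obtain ⟨e, he⟩ := exists_codim h
  have key : ∀ k : ℕ, ∀ (W : Submodule R R) (u : R), e W = k → u ∈ I → u ∈ W →
      (∀ w ∈ W, w * u = 0 → w = 0) → ∃ c ∈ I, c ∈ lReg R := by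
    intro k
    induction k using Nat.strong_induction_on with
    | _ k ih =>
      intro W u hk huI huW hinj
      by_cases hl : colon ⊥ u = ⊥
      · refine ⟨u, huI, fun x hx => ?_⟩
        have : x ∈ colon ⊥ u := mem_colon.2 (by simpa using hx)
        rw [hl] at this
        simpa using this
      · obtain ⟨U, hUle, hU⟩ := exists_uniform h (hI _ hl)
        obtain ⟨v, hvU, hv⟩ := hC U hU
        have hUu : ∀ y ∈ U, y * u = 0 := fun y hy => by
          have := mem_colon.1 (hUle hy).2
          simpa using this
        have hd : Disjoint W U := by
          rw [Submodule.disjoint_def]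
          intro x hxW hxU
          exact hinj x hxW (hUu x hxU)
        refine ih _ (hk ▸ he U W hU.1 hd) (W ⊔ U) (u + v) rfl
          (I.add_mem huI (hUle hvU).1)
          (Submodule.add_mem_sup huW hvU) ?_
        intro x hx hx0
        obtain ⟨w, hw, y, hy, rfl⟩ := Submodule.mem_sup.1 hx
        have h1 : w * u + (w * v + y * v) = 0 := by
          have := hUu y hy
          rw [← hx0, add_mul, mul_add, mul_add, this]
          abel
        have hwuW : w * u ∈ W := W.smul_mem w huW
        have hU2 : w * v + y * v ∈ U := U.add_mem (U.smul_mem w hvU) (U.smul_mem y hvU)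
        have h2 : w * u = 0 := by
          refine (Submodule.disjoint_def.1 hd) _ hwuW ?_
          rw [eq_neg_of_add_eq_zero_left h1]
          exact U.neg_mem hU2
        have hw0 := hinj w hw h2
        subst hw0
        rw [zero_mul, zero_mul, zero_add, zero_add] at h1
        rw [hv y hy h1, add_zero]
  exact key _ ⊥ 0 rfl I.zero_mem (Submodule.zero_mem _) (by intro w hw _; simpa using hw)

lemma lReg_mul {a b : R} (ha : a ∈ lReg R) (hb : b ∈ lReg R) : a * b ∈ lReg R := by
  intro x hx
  rw [← mul_assoc] at hx
  exact ha _ (hb _ hx)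

/-- `R c` is essential if `c` is left regular. -/
lemma ess_span_of_lReg (h : FinUdim R) {c : R} (hc : c ∈ lReg R) :
    EssIdeal (Submodule.span R {c}) := by
  obtain ⟨e, he⟩ := exists_codim h
  intro L hL hcL
  have hdis : ∀ l ∈ L, ∀ a : R, l = a * c → l = 0 ∧ a = 0 := by
    intro l hl a ha
    have hm : l ∈ Submodule.span R {c} ⊓ L :=
      ⟨Submodule.mem_span_singleton.2 ⟨a, ha.symm⟩, hl⟩
    rw [hcL, Submodule.mem_bot] at hm
    exact ⟨hm, hc a (by rw [← ha, hm])⟩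
  let W : ℕ → Submodule R R := fun k => Nat.rec ⊥ (fun _ W => L ⊔ mulR W c) k
  have hWs : ∀ k, W (k + 1) = L ⊔ mulR (W k) c := fun k => rfl
  have hmm : ∀ (k : ℕ), mulR (mulR L (c ^ k)) c = mulR L (c ^ (k + 1)) := by
    intro k
    ext y
    simp only [mem_mulR]
    constructor
    · rintro ⟨_, ⟨j, hj, rfl⟩, rfl⟩
      exact ⟨j, hj, by rw [pow_succ, mul_assoc]⟩
    · rintro ⟨j, hj, rfl⟩
      exact ⟨_, ⟨j, hj, rfl⟩, by rw [pow_succ, mul_assoc]⟩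
  have hW2 : ∀ k, W (k + 1) = W k ⊔ mulR L (c ^ k) := by
    intro k
    induction k with
    | zero =>
      rw [hWs]
      have h0 : W 0 = ⊥ := rfl
      have h1 : mulR L (c ^ 0) = L := by
        ext y; simp [mem_mulR]
      rw [h0, h1]
      simp [mulR]
    | succ k ih =>
      rw [hWs (k + 1), ih]
      have : mulR (W k ⊔ mulR L (c ^ k)) c = mulR (W k) c ⊔ mulR L (c ^ (k + 1)) := by
        rw [← hmm k]
        exact Submodule.map_sup _ _ _
      rw [this, ← sup_assoc, ← hWs k, ih]
  have hd : ∀ k, Disjoint (W k) (mulR L (c ^ k)) := by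
    intro k
    induction k with
    | zero => exact disjoint_bot_left
    | succ k ih =>
      rw [Submodule.disjoint_def]
      intro x hx hx'
      rw [hWs] at hx
      obtain ⟨l, hl, y, hy, rfl⟩ := Submodule.mem_sup.1 hx
      obtain ⟨w, hw, rfl⟩ := mem_mulR.1 hy
      obtain ⟨l', hl', hle⟩ := mem_mulR.1 hx'
      have h1 : l = (l' * c ^ k - w) * c := by
        rw [sub_mul, mul_assoc, ← pow_succ, hle]; abel
      obtain ⟨h2, h3⟩ := hdis l hl _ h1
      have h4 : w = 0 := by
        refine (Submodule.disjoint_def.1 ih) w hw ?_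
        rw [← sub_eq_zero.1 h3]
        exact mem_mulR.2 ⟨l', hl', rfl⟩
      rw [h2, h4, zero_mul, add_zero]
  have hne : ∀ k, mulR L (c ^ k) ≠ ⊥ := by
    intro k
    obtain ⟨l, hl, hl0⟩ := exists_ne_of_ne_bot hL
    refine ne_bot_of_mem (mem_mulR.2 ⟨l, hl, rfl⟩) ?_
    intro h0
    apply hl0
    have hck : c ^ k ∈ lReg R := by
      clear h0
      induction k with
      | zero => intro x hx; simpa using hx
      | succ k ih => rw [pow_succ]; exact lReg_mul ih hc
    exact hck l h0
  have hdec : ∀ k, e (W (k + 1)) < e (W k) := by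
    intro k
    rw [hW2]
    exact he _ _ (hne k) (hd k)
  have : ∀ k, e (W k) + k ≤ e (W 0) := by
    intro k
    induction k with
    | zero => simp
    | succ k ih => have := hdec k; omega
  have := this (e (W 0) + 1)
  omega

/-- Left Ore property of the left regular elements. -/
lemma lReg_ore (h : FinUdim R)
    (hC : ∀ U : Submodule R R, UniformIdeal U → (lRegIn U).Nonempty)
    {s : R} (hs : s ∈ lReg R) (r : R) : ∃ s' ∈ lReg R, ∃ r' : R, s' * r = r' * s := by
  obtain ⟨c, hcI, hc⟩ := exists_lReg_of_ess h hC (ess_colon (ess_span_of_lReg h hs) r)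
  obtain ⟨a, ha⟩ := Submodule.mem_span_singleton.1 (mem_colon.1 hcI)
  exact ⟨c, hc, a, ha.symm⟩

/-- Under the hypotheses of (3), left regular elements are regular. -/
lemma lReg_sub_rReg (hsp : SemiprimeRing R) (h : FinUdim R)
    (hacc : AccOnSets {A : Set R | ∃ c ∈ lReg R, A = {x : R | c * x = 0}})
    (hC : ∀ U : Submodule R R, UniformIdeal U → (lRegIn U).Nonempty) :
    lReg R ⊆ rReg R := by
  have h1 : (1 : R) ∈ lReg R := fun x hx => by simpa using hx
  have hmax : ∃ c ∈ lReg R, ∀ d ∈ lReg R, ∀ x : R, d * x = 0 → c * x = 0 := by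
    by_contra hcon
    push Not at hcon
    have step : ∀ c : lReg R, ∃ d : lReg R,
        (∀ x : R, (c : R) * x = 0 → (d : R) * x = 0) ∧
        ∃ x : R, (d : R) * x = 0 ∧ (c : R) * x ≠ 0 := by
      rintro ⟨c, hc⟩
      obtain ⟨d, hd, x, hdx, hcx⟩ := hcon c hc
      obtain ⟨s, hs, r, hsr⟩ := lReg_ore h hC hc d
      refine ⟨⟨s * d, lReg_mul hs hd⟩, ?_, x, ?_, hcx⟩
      · intro y hy
        change s * d * y = 0
        rw [hsr, mul_assoc, hy, mul_zero]
      · change s * d * x = 0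
        rw [mul_assoc, hdx, mul_zero]
    choose F hF1 hF2 using step
    let g : ℕ → lReg R := fun n => F^[n] ⟨1, h1⟩
    have hg : ∀ n, g (n + 1) = F (g n) := fun n => Function.iterate_succ_apply' F n _
    obtain ⟨N, hN⟩ := hacc (fun n => {x : R | (g n : R) * x = 0})
      (fun n => ⟨g n, (g n).2, rfl⟩)
      (fun n x hx => by
        change (g (n + 1) : R) * x = 0
        rw [hg]
        exact hF1 _ x hx)
    obtain ⟨x, hx1, hx2⟩ := hF2 (g N)
    have := hN (N + 1) (Nat.le_succ N)
    have hx : x ∈ {x : R | (g (N + 1) : R) * x = 0} := by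
      change (g (N + 1) : R) * x = 0
      rw [hg]; exact hx1
    rw [this] at hx
    exact hx2 hx
  obtain ⟨c, hc, hcmax⟩ := hmax
  have hker : ∀ z : R, c * z = 0 → z = 0 := by
    intro z hz
    have hrz : ∀ r : R, c * (r * z) = 0 := by
      intro r
      obtain ⟨s, hs, r', hsr⟩ := lReg_ore h hC hc r
      apply hcmax s hs
      rw [← mul_assoc, hsr, mul_assoc, hz, mul_zero]
    apply hc
    apply hsp
    intro r
    calc z * c * r * (z * c) = z * (c * (r * z)) * c := by noncomm_ring
      _ = 0 := by rw [hrz, mul_zero, zero_mul]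
  intro d hd x hx
  exact hker x (hcmax d hd x hx)

/-- Semisimplicity of the localization. -/
lemma semisimple_of_loc (h : FinUdim R)
    (hC : ∀ U : Submodule R R, UniformIdeal U → (lRegIn U).Nonempty)
    (hreg : lReg R ⊆ rReg R) {Q : Type u} [Ring Q] (f : R →+* Q)
    (hf : IsLeftLoc (reg R) f) : IsSemisimpleRing Q := by
  obtain ⟨hf1, hf2, hf3⟩ := hf
  have hinj : ∀ r : R, f r = 0 → r = 0 := by
    intro r hr
    obtain ⟨s, hs, hsr⟩ := (hf3 r).1 hr
    exact hs.2 r hsr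
  have hess : ∀ E : Submodule R R, EssIdeal E → ∃ s ∈ E, s ∈ reg R := by
    intro E hE
    obtain ⟨c, hcE, hc⟩ := exists_lReg_of_ess h hC hE
    exact ⟨c, hcE, hc, hreg hc⟩
  have hsimple : ∀ U : Submodule R R, UniformIdeal U → ∀ u ∈ U, u ≠ 0 →
      IsSimpleModule Q (Submodule.span Q {f u}) := by
    intro U hU u hu hu0
    rw [isSimpleModule_iff_isAtom]
    refine ⟨?_, ?_⟩
    · intro hb
      rw [Submodule.span_singleton_eq_bot] at hb
      exact hu0 (hinj u hb)
    · intro K hK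
      by_contra hK0
      apply hK.not_ge
      obtain ⟨q, hqK, hq0⟩ := (Submodule.ne_bot_iff K).1 hK0
      obtain ⟨a, rfl⟩ := Submodule.mem_span_singleton.1 (hK.le hqK)
      obtain ⟨s, hs, r, hsr⟩ := hf2 a
      have hru : f (r * u) ∈ K := by
        rw [map_mul, ← hsr, mul_assoc]
        exact K.smul_mem (f s) hqK
      have hru0 : r * u ≠ 0 := by
        intro h0
        apply hq0
        have : f s * (a * f u) = 0 := by rw [← mul_assoc, hsr, ← map_mul, h0, map_zero]
        exact ((hf1 s hs).mul_right_eq_zero).1 this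
      have hcol : EssIdeal (colon (Submodule.span R {r * u}) u) := by
        refine ess_colon_rel (M := U) (fun W hW hW0 => ?_) hu
        refine hU.2 _ W ?_ hW (ne_bot_of_mem (Submodule.mem_span_singleton_self _) hru0) hW0
        rw [Submodule.span_singleton_le_iff_mem]
        exact U.smul_mem r hu
      obtain ⟨t, htE, ht⟩ := hess _ hcol
      obtain ⟨b, hb⟩ := Submodule.mem_span_singleton.1 (mem_colon.1 htE)
      have hb' : f b * f (r * u) = f t * f u := by
        rw [← map_mul, ← map_mul]; exact congrArg f hb
      rw [Submodule.span_singleton_le_iff_mem]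
      obtain ⟨v, hv⟩ := hf1 t ht
      have : f u = (↑v⁻¹ * f b) * f (r * u) := by
        rw [mul_assoc, hb', ← hv, Units.inv_mul_cancel_left]
      rw [this]
      exact K.smul_mem _ hru
  apply IsSemisimpleModule.of_sSup_simples_eq_top
  set S := sSup {m : Submodule Q Q | IsSimpleModule Q m} with hS
  obtain ⟨n, U, hU, -, hUess⟩ := id h
  have hle : (⨆ i, U i) ≤ Ideal.comap f S := by
    refine iSup_le fun i u hu => ?_
    by_cases hu0 : u = 0
    · rw [hu0]; exact Submodule.zero_mem _
    · change f u ∈ S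
      have : Submodule.span Q {f u} ≤ S := le_sSup (hsimple _ (hU i) u hu hu0)
      exact this (Submodule.mem_span_singleton_self _)
  obtain ⟨s, hsE, hs⟩ := hess _ hUess
  have hfs : f s ∈ S := hle hsE
  exact Ideal.eq_top_of_isUnit_mem S hfs (hf1 s hs)

lemma one_of_three (hsp : SemiprimeRing R) (h : FinUdim R)
    (hacc : AccOnSets {A : Set R | ∃ c ∈ lReg R, A = {x : R | c * x = 0}})
    (hC : ∀ U : Submodule R R, UniformIdeal U → (lRegIn U).Nonempty) :
    (IsLeftOre (reg R) ∧
        ∃ (Q : Type u) (_ : Ring Q) (f : R →+* Q),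
          IsLeftLoc (reg R) f ∧ IsSemisimpleRing Q) := by
  have hreg := lReg_sub_rReg hsp h hacc hC
  have hmul : IsMulSet (reg R) := by
    refine ⟨⟨fun x hx => by simpa using hx, fun x hx => by simpa using hx⟩, ?_, ?_⟩
    · intro a ha b hb
      have := lReg_mul ha.1 hb.1
      exact ⟨this, hreg this⟩
    · intro h0
      obtain ⟨n, U, hU, -⟩ := h
      obtain ⟨x, _, hx0⟩ := exists_ne_of_ne_bot (hU 0).1
      exact hx0 (h0.1 x (mul_zero x))
  have hore : ∀ s ∈ reg R, ∀ r : R, ∃ s' ∈ reg R, ∃ r' : R, s' * r = r' * s := by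
    intro s hs r
    obtain ⟨s', hs', r', hr⟩ := lReg_ore h hC hs.1 r
    exact ⟨s', ⟨hs', hreg hs'⟩, r', hr⟩
  refine ⟨⟨hmul, hore⟩, ?_⟩
  let S : Submonoid R :=
    { carrier := reg R
      one_mem' := hmul.1
      mul_mem' := fun {a b} ha hb => hmul.2.1 a ha b hb }
  have hore' : ∀ (r : R) (s : S), ∃ (p : R × S), (p.2 : R) * r = p.1 * s := by
    intro r s
    obtain ⟨s', hs', r', hr⟩ := hore s s.2 r
    exact ⟨(r', ⟨s', hs'⟩), hr⟩
  choose P hP using hore'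
  let _ : OreLocalization.OreSet S :=
    { ore_right_cancel := fun r₁ r₂ s hr => ⟨1, by
        have h0 : (r₁ - r₂) * (s : R) = 0 := by rw [sub_mul, hr, sub_self]
        rw [sub_eq_zero.1 (s.2.1 _ h0)]⟩
      oreNum := fun r s => (P r s).1
      oreDenom := fun r s => (P r s).2
      ore_eq := hP }
  let f : R →+* OreLocalization S R := OreLocalization.numeratorRingHom
  have hloc : IsLeftLoc (reg R) f := by
    refine ⟨fun s hs => OreLocalization.numerator_isUnit (⟨s, hs⟩ : S), ?_, ?_⟩
    · intro q
      induction q using OreLocalization.ind with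
      | _ r s =>
        refine ⟨s, s.2, r, ?_⟩
        exact OreLocalization.mul_cancel
    · intro r
      have hinj : Function.Injective f := by
        apply OreLocalization.numeratorHom_inj
        intro s hs
        first
          | exact fun x hx => hs.1 x hx
          | exact fun x hx => hs.2 x hx
      constructor
      · intro hr
        refine ⟨1, hmul.1, ?_⟩
        rw [one_mul]
        exact hinj (by rw [hr, map_zero])
      · rintro ⟨s, hs, hsr⟩
        rw [hs.2 r hsr, map_zero]
  exact ⟨OreLocalization S R, inferInstance, f, hloc, semisimple_of_loc h hC hreg f hloc⟩

/-- (1) implies (2). -/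
lemma two_of_one (hO : IsLeftOre (reg R)) {Q : Type u} [Ring Q] (f : R →+* Q)
    (hf : IsLeftLoc (reg R) f) (hss : IsSemisimpleRing Q) :
    SemiprimeRing R ∧ FinUdim R ∧
        AccOnSets {A : Set R | ∃ X : Set R, A = rAnn X} ∧
        ∀ U : Submodule R R, UniformIdeal U → (lRegIn U).Nonempty := by
  obtain ⟨⟨h1, hmul, h0⟩, hore⟩ := hO
  obtain ⟨hf1, hf2, hf3⟩ := hf
  have hinj0 : ∀ r : R, f r = 0 → r = 0 := by
    intro r hr
    obtain ⟨s, hs, hsr⟩ := (hf3 r).1 hr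
    exact hs.2 r hsr
  have hinj : ∀ a b : R, f a = f b → a = b := by
    intro a b hab
    exact sub_eq_zero.1 (hinj0 _ (by rw [map_sub, hab, sub_self]))
  -- the localization of a left ideal
  have hloc : ∀ E : Submodule R R, ∃ K : Submodule Q Q,
      ∀ q : Q, q ∈ K ↔ ∃ s ∈ reg R, ∃ e ∈ E, f s * q = f e := by
    intro E
    refine ⟨{ carrier := {q | ∃ s ∈ reg R, ∃ e ∈ E, f s * q = f e}
              zero_mem' := ⟨1, h1, 0, E.zero_mem, by simp⟩
              add_mem' := ?_
              smul_mem' := ?_ }, fun q => Iff.rfl⟩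
    · rintro p q ⟨s, hs, a, ha, hsa⟩ ⟨t, ht, b, hb, htb⟩
      obtain ⟨t', ht', r', hr⟩ := hore t ht s
      refine ⟨t' * s, hmul _ ht' _ hs, t' * a + r' * b,
        E.add_mem (E.smul_mem t' ha) (E.smul_mem r' hb), ?_⟩
      rw [mul_add, map_add, map_mul f t' a, map_mul f r' b, ← hsa, ← htb]
      congr 1
      · rw [map_mul, mul_assoc]
      · rw [hr, map_mul, mul_assoc]
    · rintro p q ⟨s, hs, a, ha, hsa⟩
      obtain ⟨t, ht, b, htb⟩ := hf2 p
      obtain ⟨s', hs', r', hr⟩ := hore s hs b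
      refine ⟨s' * t, hmul _ hs' _ ht, r' * a, E.smul_mem r' ha, ?_⟩
      calc f (s' * t) * (p * q) = f s' * (f t * p) * q := by
            rw [map_mul]; simp only [mul_assoc]
        _ = f (s' * b) * q := by rw [htb, map_mul]
        _ = f (r' * a) := by rw [hr, map_mul, mul_assoc, hsa, map_mul]
  -- essential left ideals contain regular elements
  have hess : ∀ E : Submodule R R, EssIdeal E → ∃ s ∈ E, s ∈ reg R := by
    intro E hE
    obtain ⟨K, hK⟩ := hloc E
    obtain ⟨L, hL⟩ := exists_isCompl K
    have hL0 : L = ⊥ := by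
      rw [Submodule.eq_bot_iff]
      intro q hq
      have hJ : Ideal.comap f L = ⊥ := by
        by_contra hne
        obtain ⟨x, ⟨hxE, hxL⟩, hx0⟩ := exists_ne_of_ne_bot (hE _ hne)
        have hxK : f x ∈ K := (hK _).2 ⟨1, h1, x, hxE, by simp⟩
        exact hx0 (hinj0 x ((Submodule.disjoint_def.1 hL.disjoint) _ hxK hxL))
      obtain ⟨s, hs, r, hsr⟩ := hf2 q
      have hr : r ∈ Ideal.comap f L := by
        change f r ∈ L
        rw [← hsr]
        exact L.smul_mem _ hq
      rw [hJ] at hr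
      have hr0 : r = 0 := by simpa using hr
      rw [hr0, map_zero] at hsr
      exact ((hf1 s hs).mul_right_eq_zero).1 hsr
    have hKt : K = ⊤ := by
      have := hL.sup_eq_top
      rwa [hL0, sup_bot_eq] at this
    obtain ⟨s, hs, e, he, hse⟩ := (hK 1).1 (by rw [hKt]; trivial)
    rw [mul_one] at hse
    exact ⟨s, by rw [hinj _ _ hse]; exact he, hs⟩
  have hsp : SemiprimeRing R := by
    intro x hx
    -- right annihilator of the ideal generated by x
    let A : Submodule R R :=
      { carrier := {y | ∀ r : R, x * r * y = 0}
        zero_mem' := fun r => mul_zero _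
        add_mem' := fun {a b} ha hb r => by rw [mul_add, ha r, hb r, add_zero]
        smul_mem' := fun c a ha r => by
          have := ha (r * c)
          rw [smul_eq_mul, ← mul_assoc, mul_assoc x r c, this] }
    have hA : EssIdeal A := by
      intro J hJ
      obtain ⟨j, hj, hj0⟩ := exists_ne_of_ne_bot hJ
      by_cases hjA : j ∈ A
      · exact ne_bot_of_mem (x := j) ⟨hjA, hj⟩ hj0
      · have : ∃ r, x * r * j ≠ 0 := by
          by_contra hcon
          push Not at hcon
          exact hjA hcon
        obtain ⟨r, hr⟩ := this
        refine ne_bot_of_mem (x := x * r * j) ⟨?_, J.smul_mem (x * r) hj⟩ hr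
        intro t
        calc x * t * (x * r * j) = (x * t * x) * (r * j) := by simp only [mul_assoc]
          _ = 0 := by rw [hx, zero_mul]
    obtain ⟨s, hsA, hs⟩ := hess A hA
    have := hsA 1
    rw [mul_one] at this
    exact hs.1 x this
  refine ⟨hsp, ?_, ?_, ?_⟩
  · obtain ⟨T, hind, hsup, hsimp⟩ := IsSemisimpleModule.exists_sSupIndep_sSup_simples_eq_top Q Q
    have hfin : T.Finite := WellFoundedGT.finite_of_sSupIndep hind
    haveI := hfin.to_subtype
    have hne : T.Nonempty := by
      rw [Set.nonempty_iff_ne_empty]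
      rintro rfl
      rw [sSup_empty] at hsup
      have h1' : (1 : Q) ∈ (⊥ : Submodule Q Q) := by rw [hsup]; trivial
      have h10 : (1 : R) = 0 := hinj0 1 (by rw [map_one]; simpa using h1')
      exact h0 (h10 ▸ h1)
    obtain ⟨m, ⟨eq⟩⟩ := Finite.exists_equiv_fin T
    obtain ⟨n, rfl⟩ : ∃ n, m = n + 1 := by
      cases m with
      | zero =>
        obtain ⟨t, ht⟩ := hne
        exact (eq ⟨t, ht⟩).elim0
      | succ n => exact ⟨n, rfl⟩
    let V : Fin (n + 1) → Submodule Q Q := fun i => (eq.symm i : Submodule Q Q)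
    have hVs : ∀ i, IsAtom (V i) := fun i => by
      rw [← isSimpleModule_iff_isAtom]
      exact hsimp _ (eq.symm i).2
    have hVsup : (⨆ i, V i) = ⊤ := by
      rw [← hsup, sSup_eq_iSup']
      exact eq.symm.iSup_comp (g := fun t : T => (t : Submodule Q Q))
    have hVind : iSupIndep V := by
      have := (sSupIndep_iff T).1 hind
      exact this.comp eq.symm.injective
    have hdense : ∀ q : Q, q ≠ 0 → ∃ s ∈ reg R, ∃ r : R, r ≠ 0 ∧ f s * q = f r := by
      intro q hq
      obtain ⟨s, hs, r, hsr⟩ := hf2 q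
      refine ⟨s, hs, r, ?_, hsr⟩
      rintro rfl
      rw [map_zero] at hsr
      exact hq (((hf1 s hs).mul_right_eq_zero).1 hsr)
    refine ⟨n, fun i => Ideal.comap f (V i), ?_, ?_, ?_⟩
    · intro i
      refine ⟨?_, ?_⟩
      · obtain ⟨q, hq, hq0⟩ := (Submodule.ne_bot_iff _).1 (hVs i).1
        obtain ⟨s, hs, r, hr0, hsr⟩ := hdense q hq0
        refine ne_bot_of_mem (x := r) ?_ hr0
        change f r ∈ V i
        rw [← hsr]
        exact (V i).smul_mem _ hq
      · intro A B hA hB hA0 hB0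
        obtain ⟨a, ha, ha0⟩ := exists_ne_of_ne_bot hA0
        obtain ⟨b, hb, hb0⟩ := exists_ne_of_ne_bot hB0
        have hfa : f a ∈ V i := hA ha
        have hfb : f b ∈ V i := hB hb
        have hspan : Submodule.span Q {f a} = V i := by
          have hle : Submodule.span Q {f a} ≤ V i := by
            rw [Submodule.span_singleton_le_iff_mem]; exact hfa
          rcases (hVs i).le_iff.1 hle with h | h
          · rw [Submodule.span_singleton_eq_bot] at h
            exact absurd (hinj0 a h) ha0
          · exact h
        rw [← hspan] at hfb
        obtain ⟨q, hq⟩ := Submodule.mem_span_singleton.1 hfb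
        obtain ⟨s, hs, r, hsr⟩ := hf2 q
        have heq : s * b = r * a := by
          apply hinj
          rw [map_mul, map_mul, ← hq, ← hsr, smul_eq_mul, mul_assoc]
        refine ne_bot_of_mem (x := s * b) ⟨?_, B.smul_mem s hb⟩ ?_
        · rw [heq]; exact A.smul_mem r ha
        · intro hsb
          exact hb0 (hs.2 b hsb)
    · intro i
      rw [Submodule.eq_bot_iff]
      rintro x ⟨hx1, hx2⟩
      have hle : (⨆ j, ⨆ (_ : j ≠ i), Ideal.comap f (V j)) ≤
          Ideal.comap f (⨆ j, ⨆ (_ : j ≠ i), V j) := by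
        refine iSup₂_le fun j hj => Ideal.comap_mono ?_
        exact le_iSup₂_of_le j hj le_rfl
      have hx2' : f x ∈ ⨆ j, ⨆ (_ : j ≠ i), V j := hle hx2
      exact hinj0 x ((Submodule.disjoint_def.1 (hVind i)) _ hx1 hx2')
    · intro J hJ
      obtain ⟨K, hK⟩ := hloc (⨆ i, Ideal.comap f (V i))
      have hKt : K = ⊤ := by
        rw [eq_top_iff, ← hVsup]
        refine iSup_le fun i q hq => ?_
        obtain ⟨s, hs, r, hsr⟩ := hf2 q
        refine (hK q).2 ⟨s, hs, r, ?_, hsr⟩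
        have : Ideal.comap f (V i) ≤ ⨆ i, Ideal.comap f (V i) :=
          le_iSup (fun i => Ideal.comap f (V i)) i
        apply this
        change f r ∈ V i
        rw [← hsr]
        exact (V i).smul_mem _ hq
      obtain ⟨j, hj, hj0⟩ := exists_ne_of_ne_bot hJ
      obtain ⟨s, hs, e, he, hse⟩ := (hK (f j)).1 (by rw [hKt]; trivial)
      rw [← map_mul] at hse
      have hse' := hinj _ _ hse
      refine ne_bot_of_mem (x := s * j) ⟨?_, J.smul_mem s hj⟩ ?_
      · rw [hse']; exact he
      · intro hz
        exact hj0 (hs.2 j hz)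
  · intro g hg hmono
    have hmono' : Monotone g := monotone_nat_of_le_succ hmono
    let L : ℕ →o (Submodule Q Q)ᵒᵈ :=
      { toFun := fun n => OrderDual.toDual
          { carrier := {q | ∀ x ∈ g n, q * f x = 0}
            zero_mem' := fun x _ => zero_mul _
            add_mem' := fun {a b} ha hb x hx => by rw [add_mul, ha x hx, hb x hx, add_zero]
            smul_mem' := fun c a ha x hx => by
              rw [smul_eq_mul, mul_assoc, ha x hx, mul_zero] }
        monotone' := fun m n hmn q hq x hx => hq x (hmono' hmn hx) }
    obtain ⟨N, hN⟩ := IsArtinian.monotone_stabilizes L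
    refine ⟨N, fun n hn => ?_⟩
    refine Set.Subset.antisymm ?_ (hmono' hn)
    intro x hx
    obtain ⟨X, hX⟩ := hg N
    rw [hX]
    intro y hy
    have hyN : f y ∈ OrderDual.ofDual (L N) := by
      intro z hz
      rw [hX] at hz
      rw [← map_mul, hz y hy, map_zero]
    rw [hN n hn] at hyN
    have := hyN x hx
    rw [← map_mul] at this
    exact hinj0 _ this
  · intro U hU
    obtain ⟨u, hu, hu0⟩ := exists_ne_of_ne_bot hU.1
    have : ∃ r, u * r * u ≠ 0 := by
      by_contra hcon
      push Not at hcon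
      exact hu0 (hsp u hcon)
    obtain ⟨r, hr⟩ := this
    refine ⟨r * u, U.smul_mem r hu, ?_⟩
    by_contra hcon
    push Not at hcon
    obtain ⟨x, hxU, hx, hx0⟩ := hcon
    have hKne : U ⊓ colon ⊥ (r * u) ≠ ⊥ :=
      ne_bot_of_mem (x := x) ⟨hxU, mem_colon.2 (by simpa using hx)⟩ hx0
    have hE := ess_colon_rel (K := U ⊓ colon ⊥ (r * u)) (M := U)
      (fun W hW hW0 => hU.2 _ W inf_le_left hW hKne hW0) hu
    obtain ⟨s, hsE, hs⟩ := hess _ hE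
    have h2 := mem_colon.1 (mem_colon.1 hsE).2
    rw [Submodule.mem_bot] at h2
    apply hr
    rw [mul_assoc]
    apply hs.2
    rw [← mul_assoc]
    exact h2

lemma acc_mono {P P' : Set (Set R)} (h : P ⊆ P') (hP : AccOnSets P') : AccOnSets P :=
  fun f hf => hP f (fun n => h (hf n))

end Helpers

/-- Theorem B26Feb15: semisimplicity criteria for the classical left quotient ring
`Q_{l,cl}(R) = C_R⁻¹R` in terms of right annihilators and left regular elements. -/
theorem classicalLeftQuotient_semisimple_iff_rightAnn {R : Type u} [Ring R] :
    -- (1) ↔ (2)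
    ((IsLeftOre (reg R) ∧
        ∃ (Q : Type u) (_ : Ring Q) (f : R →+* Q),
          IsLeftLoc (reg R) f ∧ IsSemisimpleRing Q) ↔
      (SemiprimeRing R ∧ FinUdim R ∧
        AccOnSets {A : Set R | ∃ X : Set R, A = rAnn X} ∧
        ∀ U : Submodule R R, UniformIdeal U → (lRegIn U).Nonempty)) ∧
    -- (1) ↔ (3)
    ((IsLeftOre (reg R) ∧
        ∃ (Q : Type u) (_ : Ring Q) (f : R →+* Q),
          IsLeftLoc (reg R) f ∧ IsSemisimpleRing Q) ↔
      (SemiprimeRing R ∧ FinUdim R ∧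
        AccOnSets {A : Set R | ∃ c ∈ lReg R, A = {x : R | c * x = 0}} ∧
        ∀ U : Submodule R R, UniformIdeal U → (lRegIn U).Nonempty)) ∧
    -- (1) ↔ (4)
    ((IsLeftOre (reg R) ∧
        ∃ (Q : Type u) (_ : Ring Q) (f : R →+* Q),
          IsLeftLoc (reg R) f ∧ IsSemisimpleRing Q) ↔
      (SemiprimeRing R ∧ FinUdim R ∧
        AccOnSets {A : Set R | ∃ r : R, A = {x : R | r * x = 0}} ∧
        ∀ U : Submodule R R, UniformIdeal U → (lRegIn U).Nonempty)) := by
  have h24 : AccOnSets {A : Set R | ∃ X : Set R, A = rAnn X} →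
      AccOnSets {A : Set R | ∃ r : R, A = {x : R | r * x = 0}} := by
    refine acc_mono ?_
    rintro A ⟨r, rfl⟩
    exact ⟨{r}, by ext x; simp [rAnn]⟩
  have h43 : AccOnSets {A : Set R | ∃ r : R, A = {x : R | r * x = 0}} →
      AccOnSets {A : Set R | ∃ c ∈ lReg R, A = {x : R | c * x = 0}} := by
    refine acc_mono ?_
    rintro A ⟨r, _, rfl⟩
    exact ⟨r, rfl⟩
  refine ⟨⟨?_, ?_⟩, ⟨?_, ?_⟩, ⟨?_, ?_⟩⟩
  · rintro ⟨hO, Q, _, f, hf, hss⟩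
    exact two_of_one hO f hf hss
  · rintro ⟨a, b, c, d⟩
    exact one_of_three a b (h43 (h24 c)) d
  · rintro ⟨hO, Q, _, f, hf, hss⟩
    obtain ⟨a, b, c, d⟩ := two_of_one hO f hf hss
    exact ⟨a, b, h43 (h24 c), d⟩
  · rintro ⟨a, b, c, d⟩
    exact one_of_three a b c d
  · rintro ⟨hO, Q, _, f, hf, hss⟩
    obtain ⟨a, b, c, d⟩ := two_of_one hO f hf hss
    exact ⟨a, b, h24 c, d⟩
  · rintro ⟨a, b, c, d⟩
    exact one_of_three a b (h43 c) d

end Bavula
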